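/- Let p be an odd prime and N a prime with N ≡ 1 (mod p). Then rk_p(Cl(L)) ≤ p · rk_p(Cl(K)) + (3/2)(p-1)², where K = Q(ζ_p) and L = Q(ζ_p, N^{1/p}). -/

import Mathlib

open NumberField Polynomial

/-- The `p`-rank of a finite abelian group `G`: the `𝔽_p`-dimension of `G ⊗ 𝔽_p`,
equivalently of `G[p]`. -/
noncomputable def pRank (p : ℕ) (G : Type*) [Group G] : ℕ :=
  (Nat.card {g : G // g ^ p = 1}).factorization p

open scoped Pointwise nonZeroDivisors

/-- The `p`-torsion subgroup. -/
def tors (p : ℕ) (G : Type*) [CommGroup G] : Subgroup G := (powMonoidHom p : G →* G).ker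

lemma mem_tors {p : ℕ} {G : Type*} [CommGroup G] {g : G} : g ∈ tors p G ↔ g ^ p = 1 := Iff.rfl

lemma card_tors_quot (p : ℕ) (A : Type*) [CommGroup A] [Finite A] :
    Nat.card (tors p A) = (powMonoidHom p : A →* A).range.index := by
  have h1 := (powMonoidHom p : A →* A).ker.card_mul_index
  have h2 := (powMonoidHom p : A →* A).range.card_mul_index
  rw [Subgroup.index_ker] at h1
  have h0 : 0 < Nat.card (powMonoidHom p : A →* A).range := Nat.card_pos
  have : Nat.card (powMonoidHom p : A →* A).ker * Nat.card (powMonoidHom p : A →* A).range =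
      (powMonoidHom p : A →* A).range.index * Nat.card (powMonoidHom p : A →* A).range := by
    rw [h1, mul_comm _ (Nat.card _), h2]
  exact Nat.eq_of_mul_eq_mul_right h0 this

/-- The size of the torsion does not grow in quotients. -/
lemma card_tors_le_of_surjective (p : ℕ) {A B : Type*} [CommGroup A] [CommGroup B] [Finite A]
    [Finite B] (f : A →* B) (hf : Function.Surjective f) :
    Nat.card (tors p B) ≤ Nat.card (tors p A) := by
  rw [card_tors_quot, card_tors_quot]
  have hle : (powMonoidHom p : A →* A).range ≤ (powMonoidHom p : B →* B).range.comap f := by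
    rintro _ ⟨a, rfl⟩
    exact ⟨f a, by simp⟩
  have := Subgroup.index_dvd_of_le hle
  rw [Subgroup.index_comap_of_surjective _ hf] at this
  exact Nat.le_of_dvd (Nat.pos_of_ne_zero Subgroup.index_ne_zero_of_finite) this

lemma card_tors_range_le (p : ℕ) {A B : Type*} [CommGroup A] [CommGroup B] [Finite A]
    [Finite B] (f : A →* B) : Nat.card (tors p f.range) ≤ Nat.card (tors p A) :=
  card_tors_le_of_surjective p f.rangeRestrict f.rangeRestrict_surjective

lemma card_tors_le_of_injective (p : ℕ) {A B : Type*} [CommGroup A] [CommGroup B] [Finite B]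
    (f : A →* B) (hf : Function.Injective f) :
    Nat.card (tors p A) ≤ Nat.card (tors p B) := by
  refine Nat.card_le_card_of_injective
    (fun a : tors p A => (⟨f a, by
      have := a.2
      rw [mem_tors] at this ⊢
      rw [← map_pow, this, map_one]⟩ : tors p B)) ?_
  intro a b h
  have := congrArg Subtype.val h
  exact Subtype.ext (hf this)

lemma card_tors_prod (p : ℕ) {A B : Type*} [CommGroup A] [CommGroup B] :
    Nat.card (tors p (A × B)) = Nat.card (tors p A) * Nat.card (tors p B) := by
  rw [← Nat.card_prod]
  refine Nat.card_congr
    { toFun := fun x => (⟨x.1.1, (Prod.ext_iff.mp (mem_tors.mp x.2)).1⟩, ⟨x.1.2, (Prod.ext_iff.mp (mem_tors.mp x.2)).2⟩)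
      invFun := fun x => ⟨(x.1.1, x.2.1), Prod.ext x.1.2 x.2.2⟩
      left_inv := fun x => rfl
      right_inv := fun x => rfl }

lemma card_tors_cyclic (p : ℕ) (hp : 0 < p) (A : Type*) [CommGroup A] [Finite A] [IsCyclic A] :
    Nat.card (tors p A) ≤ p := by
  classical
  have := Fintype.ofFinite A
  have h := IsCyclic.card_pow_eq_one_le (α := A) hp
  refine le_trans (le_of_eq ?_) h
  rw [Nat.card_eq_fintype_card, ← Fintype.card_subtype]
  exact Fintype.card_congr (Equiv.refl _)

lemma card_tors_sup_zpowers (p : ℕ) (hp : 0 < p) {A : Type*} [CommGroup A] [Finite A]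
    (H : Subgroup A) (a : A) :
    Nat.card (tors p (H ⊔ Subgroup.zpowers a : Subgroup A)) ≤ Nat.card (tors p H) * p := by
  let f : H × Subgroup.zpowers a →* (H ⊔ Subgroup.zpowers a : Subgroup A) :=
    MonoidHom.coprod (Subgroup.inclusion le_sup_left) (Subgroup.inclusion le_sup_right)
  have hf : Function.Surjective f := by
    rintro ⟨x, hx⟩
    obtain ⟨y, hy, z, hz, rfl⟩ := Subgroup.mem_sup.mp hx
    exact ⟨(⟨y, hy⟩, ⟨z, hz⟩), rfl⟩
  refine (card_tors_le_of_surjective p f hf).trans ?_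
  rw [card_tors_prod]
  exact Nat.mul_le_mul_left _ (card_tors_cyclic p hp _)

lemma card_tors_sup_closure (p : ℕ) (hp : 0 < p) {A : Type*} [CommGroup A] [Finite A]
    (H : Subgroup A) {ι : Type*} (s : Finset ι) (x : ι → A) :
    Nat.card (tors p (H ⊔ Subgroup.closure (x '' s) : Subgroup A)) ≤
      Nat.card (tors p H) * p ^ s.card := by
  classical
  induction s using Finset.induction_on with
  | empty =>
    have : (H ⊔ Subgroup.closure (x '' (∅ : Finset ι)) : Subgroup A) = H := by simp
    rw [this]; simp
  | insert i s hi ih =>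
    have : (H ⊔ Subgroup.closure (x '' (insert i s : Finset ι)) : Subgroup A) =
        (H ⊔ Subgroup.closure (x '' s)) ⊔ Subgroup.zpowers (x i) := by
      rw [Finset.coe_insert, Set.image_insert_eq, Set.insert_eq, Subgroup.closure_union,
        Subgroup.zpowers_eq_closure, sup_comm (Subgroup.closure {x i}), sup_assoc]
    rw [this, Finset.card_insert_of_notMem hi, pow_succ, ← mul_assoc]
    exact (card_tors_sup_zpowers p hp _ _).trans (Nat.mul_le_mul_right _ ih)

/-- Cardinality version of rank-nullity. -/
lemma card_ker_mul_card_range {A B : Type*} [AddCommGroup A] [AddCommGroup B]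
    (f : A →ₗ[ℤ] B) : Nat.card (LinearMap.ker f) * Nat.card (LinearMap.range f) = Nat.card A := by
  rw [Submodule.card_eq_card_quotient_mul_card (LinearMap.ker f), mul_comm,
    Nat.card_congr f.quotKerEquivRange.toEquiv, mul_comm]

lemma card_ker_pow_le {A : Type*} [AddCommGroup A] [Finite A] (d : Module.End ℤ A) (k : ℕ) :
    Nat.card (LinearMap.ker (d ^ k)) ≤ Nat.card (LinearMap.ker d) ^ k := by
  induction k with
  | zero =>
    have : LinearMap.ker (d ^ 0) = ⊥ := by
      rw [pow_zero]
      exact LinearMap.ker_id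
    rw [this]; simp
  | succ k ih =>
    let f : LinearMap.ker (d ^ (k+1)) →ₗ[ℤ] LinearMap.ker d :=
      ((d ^ k).comp (Submodule.subtype _)).codRestrict _ (by
        rintro ⟨x, hx⟩
        rw [LinearMap.mem_ker] at hx ⊢
        rw [pow_succ'] at hx
        exact hx)
    have h1 := card_ker_mul_card_range f
    rw [pow_succ]
    refine h1.symm.le.trans (Nat.mul_le_mul ?_ ?_)
    · refine le_trans ?_ ih
      refine Nat.card_le_card_of_injective
        (fun x : LinearMap.ker f => (⟨x.1.1, by
          have := congrArg Subtype.val (LinearMap.mem_ker.mp x.2)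
          exact this⟩ : LinearMap.ker (d ^ k))) ?_
      intro x y h
      have h' := congrArg Subtype.val h
      exact Subtype.ext (Subtype.ext h')
    · exact Nat.card_le_card_of_injective (fun x : LinearMap.range f => x.1) Subtype.val_injective

lemma sub_one_pow_eq (p : ℕ) [Fact p.Prime] {R : Type*} [Ring R] (hR : (p : R) = 0) (t : R) :
    (t - 1) ^ (p - 1) = ∑ i ∈ Finset.range p, t ^ i := by
  have key : ((X - 1 : (ZMod p)[X])) ^ (p - 1) = ∑ i ∈ Finset.range p, X ^ i := by
    have hne : (X - 1 : (ZMod p)[X]) ≠ 0 := by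
      have := X_sub_C_ne_zero (1 : ZMod p)
      simpa using this
    apply mul_right_cancel₀ hne
    rw [geom_sum_mul, ← pow_succ, Nat.sub_add_cancel (Fact.out : p.Prime).one_le,
      sub_pow_char, one_pow]
  have : CharP R p ∨ Subsingleton R := by
    rcases subsingleton_or_nontrivial R with h | h
    · exact Or.inr h
    · left
      exact (CharP.charP_iff_prime_eq_zero Fact.out).mpr hR
  rcases this with h | h
  · let := ZMod.algebra R p
    have := congrArg (aeval t) key
    simpa using this
  · exact Subsingleton.elim _ _

lemma card_tors_le_of_norm (p : ℕ) [Fact p.Prime] {C : Type*} [CommGroup C] [Finite C]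
    (τ : C →* C) (D : Subgroup C)
    (hN : ∀ c, ∏ i ∈ Finset.range p, (τ^[i]) c ∈ D) :
    Nat.card (tors p C) ≤ Nat.card {c : C // c ^ p = 1 ∧ τ c = c} ^ (p - 1) *
      Nat.card (tors p D) := by
  let V := tors p C
  let t0 : V →* V := (τ.comp V.subtype).codRestrict V (by
    rintro ⟨x, hx⟩
    rw [mem_tors] at hx ⊢
    simp [← map_pow, hx])
  let t : Module.End ℤ (Additive V) := (MonoidHom.toAdditive t0).toIntLinearMap
  have hpz : (p : Module.End ℤ (Additive V)) = 0 := by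
    refine LinearMap.ext fun x => ?_
    rw [Module.End.natCast_apply]
    have h' : x.toMul ^ p = 1 := Subtype.ext x.toMul.2
    exact congrArg Additive.ofMul h'
  have hti : ∀ (i : ℕ) (x : V), (((t ^ i : Module.End ℤ (Additive V)) (Additive.ofMul x)).toMul : C) = (τ^[i]) x := by
    intro i
    induction i with
    | zero => intro x; rfl
    | succ i ih =>
      intro x
      rw [pow_succ']
      rw [Function.iterate_succ_apply', ← ih]
      rfl
  have hkey := sub_one_pow_eq p hpz t
  set d : Module.End ℤ (Additive V) := t - 1 with hd
  have hcard := card_ker_mul_card_range (d ^ (p-1))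
  have e1 : Nat.card (tors p C) = Nat.card (Additive V) := rfl
  rw [e1, ← hcard]
  refine Nat.mul_le_mul ((card_ker_pow_le d (p-1)).trans ?_) ?_
  · refine Nat.pow_le_pow_left ?_ _
    refine Nat.card_le_card_of_injective
      (fun x : LinearMap.ker d => (⟨(x.1.toMul : C), x.1.toMul.2, by
        have := LinearMap.mem_ker.mp x.2
        have h2 : t x.1 = x.1 := sub_eq_zero.mp this
        exact congrArg (fun y : Additive V => (y.toMul : C)) h2⟩ :
        {c : C // c ^ p = 1 ∧ τ c = c})) ?_
    intro x y h
    have := congrArg Subtype.val h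
    exact Subtype.ext (Subtype.ext this)
  · have hmem : ∀ x : LinearMap.range (d ^ (p-1)), (x.1.toMul : C) ∈ D := by
      rintro ⟨_, ⟨x, rfl⟩⟩
      rw [hkey]
      have : (((∑ i ∈ Finset.range p, t ^ i : Module.End ℤ (Additive V)) x).toMul : C) =
        ∏ i ∈ Finset.range p, (τ^[i]) (x.toMul : C) := by
        rw [LinearMap.sum_apply]
        rw [toMul_sum, Subgroup.val_finsetProd]
        exact Finset.prod_congr rfl (fun i _ => hti i x.toMul)
      exact this ▸ hN _
    refine Nat.card_le_card_of_injective
      (fun x : LinearMap.range (d ^ (p-1)) => (⟨⟨(x.1.toMul : C), hmem x⟩, by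
        rw [mem_tors]
        exact Subtype.ext x.1.toMul.2⟩ : tors p D)) ?_
    intro x y h
    have := congrArg (fun z => (z.1.1 : C)) h
    exact Subtype.ext (Subtype.ext this)

lemma card_tors_eq_pow (p : ℕ) [Fact p.Prime] (C : Type*) [CommGroup C] [Finite C] :
    Nat.card (tors p C) = p ^ pRank p C := by
  have hP : IsPGroup p (tors p C) := fun g => ⟨1, by
    rw [pow_one]; exact Subtype.ext g.2⟩
  obtain ⟨n, hn⟩ := IsPGroup.iff_card.mp hP
  have e : Nat.card {g : C // g ^ p = 1} = Nat.card (tors p C) := rfl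
  rw [pRank, e, hn, (Fact.out : p.Prime).factorization_pow, Finsupp.single_eq_same]

section units

lemma rank_units_cyclotomic (p : ℕ) [Fact p.Prime] (hpodd : Odd p) (K : Type) [Field K] [NumberField K]
    [IsCyclotomicExtension {p} ℚ K] : NumberField.Units.rank K + 1 = (p - 1) / 2 := by
  have hp : p.Prime := Fact.out
  have h2 : 2 < p := by
    rcases hpodd with ⟨k, rfl⟩
    have := hp.two_le
    omega
  have : NeZero p := ⟨hp.ne_zero⟩
  have h1 := IsCyclotomicExtension.Rat.nrComplexPlaces_eq_totient_div_two p K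
  have h3 := IsCyclotomicExtension.Rat.nrRealPlaces_eq_zero (n := p) K h2
  have h4 := InfinitePlace.card_eq_nrRealPlaces_add_nrComplexPlaces K
  rw [h1, h3, Nat.totient_prime hp, zero_add] at h4
  rw [NumberField.Units.rank, h4]
  omega

lemma units_mod (p : ℕ) [Fact p.Prime] (hpodd : Odd p) (K : Type) [Field K] [NumberField K]
    [IsCyclotomicExtension {p} ℚ K] :
    ∃ (X : Type) (_ : Finite X) (φ : (𝓞 K)ˣ → X), Nat.card X ≤ p ^ ((p - 1) / 2) ∧
      ∀ u v, φ u = φ v → ∃ w, u = v * w ^ p := by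
  have hp : p.Prime := Fact.out
  let T := NumberField.Units.torsion K
  let P : Subgroup T := (powMonoidHom p : T →* T).range
  choose f hf hf' using NumberField.Units.exist_unique_eq_mul_prod K
  refine ⟨(T ⧸ P) × (Fin (NumberField.Units.rank K) → ZMod p), inferInstance,
    fun u => (QuotientGroup.mk (f u).1, fun i => ((f u).2 i : ZMod p)), ?_, ?_⟩
  · rw [Nat.card_prod, ← rank_units_cyclotomic p hpodd K, pow_succ']
    refine Nat.mul_le_mul ?_ ?_
    · have := card_tors_quot p T
      exact this.symm.le.trans (card_tors_cyclic p hp.pos T)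
    · simp
  · intro u v h
    rw [Prod.mk.injEq] at h
    obtain ⟨h1, h2⟩ := h
    obtain ⟨z, hz⟩ := QuotientGroup.eq.mp h1.symm
    have h3 : ∀ i, ∃ k : ℤ, (f u).2 i = (f v).2 i + p * k := by
      intro i
      have := congrFun h2 i
      rw [ZMod.intCast_eq_intCast_iff_dvd_sub] at this
      obtain ⟨k, hk⟩ := this
      exact ⟨-k, by linarith⟩
    choose k hk using h3
    refine ⟨z * ∏ i, NumberField.Units.fundSystem K i ^ k i, ?_⟩
    have hu := hf u
    have hv := hf v
    have hz' : ((f u).1 : (𝓞 K)ˣ) = (f v).1 * (z : (𝓞 K)ˣ) ^ p := by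
      have h5 : (f u).1 = (f v).1 * z ^ p := by
        have : z ^ p = (f v).1⁻¹ * (f u).1 := hz
        rw [this, mul_inv_cancel_left]
      rw [h5]; rfl
    rw [hu, hv, hz', mul_pow, mul_mul_mul_comm, ← Finset.prod_pow, ← Finset.prod_mul_distrib]
    congr 1
    refine Finset.prod_congr rfl fun i _ => ?_
    simp only [hk]
    rw [zpow_add, mul_comm (p : ℤ), zpow_mul, zpow_natCast]

end units

section classes

set_option linter.unusedSectionVars false

variable {R : Type*} [CommRing R] [IsDedekindDomain R]

open Classical in
/-- The class of an ideal (trivial for the zero ideal). -/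
noncomputable def cl (I : Ideal R) : ClassGroup R :=
  if h : I = 0 then 1 else ClassGroup.mk0 ⟨I, mem_nonZeroDivisors_iff_ne_zero.mpr h⟩

lemma cl_of_ne {I : Ideal R} (h : I ≠ 0) :
    cl I = ClassGroup.mk0 ⟨I, mem_nonZeroDivisors_iff_ne_zero.mpr h⟩ := dif_neg h

lemma cl_mul {I J : Ideal R} (hI : I ≠ 0) (hJ : J ≠ 0) : cl (I * J) = cl I * cl J := by
  rw [cl_of_ne hI, cl_of_ne hJ, cl_of_ne (mul_ne_zero hI hJ), ← map_mul]
  rfl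

lemma cl_one : cl (1 : Ideal R) = 1 := by
  rw [cl_of_ne one_ne_zero]
  exact map_one ClassGroup.mk0

lemma cl_pow {I : Ideal R} (hI : I ≠ 0) (n : ℕ) : cl (I ^ n) = cl I ^ n := by
  induction n with
  | zero => rw [pow_zero, pow_zero, cl_one]
  | succ n ih => rw [pow_succ, cl_mul (pow_ne_zero _ hI) hI, ih, pow_succ]

lemma cl_prod {ι : Type*} (s : Finset ι) (I : ι → Ideal R) (h : ∀ i ∈ s, I i ≠ 0) :
    cl (∏ i ∈ s, I i) = ∏ i ∈ s, cl (I i) := by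
  classical
  induction s using Finset.induction_on with
  | empty => rw [Finset.prod_empty, Finset.prod_empty, cl_one]
  | insert i s hi ih =>
    rw [Finset.prod_insert hi, Finset.prod_insert hi, cl_mul, ih]
    · exact fun j hj => h j (Finset.mem_insert_of_mem hj)
    · exact h i (Finset.mem_insert_self _ _)
    · exact Finset.prod_ne_zero_iff.mpr fun j hj => h j (Finset.mem_insert_of_mem hj)

lemma cl_span (x : R) : cl (Ideal.span {x}) = 1 := by
  by_cases h : Ideal.span {x} = 0
  · exact dif_pos h
  · rw [cl_of_ne h, ClassGroup.mk0_eq_one_iff]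
    exact ⟨x, rfl⟩

lemma cl_surj (c : ClassGroup R) : ∃ I : Ideal R, I ≠ 0 ∧ cl I = c := by
  obtain ⟨⟨I, hI⟩, rfl⟩ := ClassGroup.mk0_surjective c
  have := mem_nonZeroDivisors_iff_ne_zero.mp hI
  exact ⟨I, this, cl_of_ne this⟩

lemma cl_eq_cl {I J : Ideal R} (hI : I ≠ 0) (hJ : J ≠ 0) (h : cl I = cl J) :
    ∃ x y : R, x ≠ 0 ∧ y ≠ 0 ∧ Ideal.span {x} * I = Ideal.span {y} * J := by
  rw [cl_of_ne hI, cl_of_ne hJ, ClassGroup.mk0_eq_mk0_iff] at h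
  obtain ⟨x, y, hx, hy, h⟩ := h
  exact ⟨x, y, hx, hy, h⟩

lemma span_ne_zero' {x : R} (hx : x ≠ 0) : Ideal.span {x} ≠ (0 : Ideal R) := by
  rwa [Ideal.zero_eq_bot, Ne, Ideal.span_singleton_eq_bot]

variable {G : Type*} [Group G] [MulSemiringAction G R]

lemma smul_ne_zero'' (σ : G) {I : Ideal R} (hI : I ≠ 0) : σ • I ≠ 0 := by
  intro h
  apply hI
  have := congrArg (σ⁻¹ • ·) h
  simpa using this

lemma smul_span (σ : G) (x : R) : σ • Ideal.span {x} = Ideal.span {σ • x} := by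
  rw [Ideal.pointwise_smul_def, Ideal.map_span]
  simp

lemma cl_eq_of_span {I J : Ideal R} (hI : I ≠ 0) (hJ : J ≠ 0) {x y : R} (hx : x ≠ 0) (hy : y ≠ 0)
    (h : Ideal.span {x} * I = Ideal.span {y} * J) : cl I = cl J := by
  have := congrArg cl h
  rwa [cl_mul (span_ne_zero' hx) hI, cl_mul (span_ne_zero' hy) hJ, cl_span, cl_span, one_mul,
    one_mul] at this

lemma smul_ne_zero_elt (σ : G) {x : R} (hx : x ≠ 0) : σ • x ≠ 0 := by
  intro h
  apply hx
  have := congrArg (σ⁻¹ • ·) h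
  simpa using this

lemma cl_smul_congr (σ : G) {I J : Ideal R} (hI : I ≠ 0) (hJ : J ≠ 0) (h : cl I = cl J) :
    cl (σ • I) = cl (σ • J) := by
  obtain ⟨x, y, hx, hy, h⟩ := cl_eq_cl hI hJ h
  have h2 := congrArg (σ • ·) h
  simp only [smul_mul', smul_span] at h2
  exact cl_eq_of_span (smul_ne_zero'' σ hI) (smul_ne_zero'' σ hJ) (smul_ne_zero_elt σ hx)
    (smul_ne_zero_elt σ hy) h2

/-- The Galois action on classes. -/
noncomputable def act (σ : G) : ClassGroup R →* ClassGroup R :=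
  MonoidHom.mk' (fun c => cl (σ • (cl_surj c).choose)) (by
    intro a b
    have ha := (cl_surj a).choose_spec
    have hb := (cl_surj b).choose_spec
    have hab := (cl_surj (a * b)).choose_spec
    rw [← cl_mul (smul_ne_zero'' σ ha.1) (smul_ne_zero'' σ hb.1), ← smul_mul']
    exact cl_smul_congr σ hab.1 (mul_ne_zero ha.1 hb.1)
      (by rw [hab.2, cl_mul ha.1 hb.1, ha.2, hb.2]))

lemma act_cl (σ : G) {I : Ideal R} (hI : I ≠ 0) : act σ (cl I) = cl (σ • I) := by
  have ha := (cl_surj (cl I)).choose_spec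
  exact cl_smul_congr σ ha.1 hI ha.2

end classes

section galois

set_option linter.unusedSectionVars false

variable (K L : Type) [Field K] [NumberField K] [Field L] [NumberField L] [Algebra K L]

lemma ext_cl {I : Ideal (𝓞 K)} (hI : I ≠ 0) :
    ClassGroup.extendedHom (𝓞 K) (𝓞 L) (cl I) = cl (I.map (algebraMap (𝓞 K) (𝓞 L))) := by
  have h : I.map (algebraMap (𝓞 K) (𝓞 L)) ≠ 0 := Ideal.map_ne_bot_of_ne_bot hI
  rw [cl_of_ne hI, cl_of_ne h, ClassGroup.extendedHom_mk0]

/-- The product of the primes above `q`. -/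
noncomputable def Rad (q : Ideal (𝓞 K)) : Ideal (𝓞 L) := ∏ᶠ P ∈ q.primesOver (𝓞 L), P

lemma Rad_eq (q : Ideal (𝓞 K)) [q.IsMaximal] :
    Rad K L q = ∏ P ∈ (q.primesOver (𝓞 L)).toFinset, P :=
  finprod_mem_eq_toFinset_prod _ _

lemma over_ne_zero {q : Ideal (𝓞 K)} (hq : q ≠ 0) {P : Ideal (𝓞 L)}
    (hP : P ∈ q.primesOver (𝓞 L)) : P ≠ 0 := by
  have := hP.2
  exact Ideal.ne_bot_of_liesOver_of_ne_bot hq P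

lemma Rad_ne_zero {q : Ideal (𝓞 K)} [q.IsMaximal] (hq : q ≠ 0) : Rad K L q ≠ 0 := by
  rw [Rad_eq, Finset.prod_ne_zero_iff]
  intro P hP
  exact over_ne_zero K L hq (Set.mem_toFinset.mp hP)

variable [IsGalois K L]

lemma map_eq_Rad_pow {q : Ideal (𝓞 K)} [q.IsMaximal] (hq : q ≠ 0) :
    q.map (algebraMap (𝓞 K) (𝓞 L)) = Rad K L q ^ q.ramificationIdxIn (𝓞 L) := by
  rw [Ideal.map_algebraMap_eq_finsetProd_pow hq, Rad_eq, ← Finset.prod_pow]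
  refine Finset.prod_congr rfl fun P hP => ?_
  have hP := Set.mem_toFinset.mp hP
  have := hP.1
  have := hP.2
  rw [Ideal.ramificationIdxIn_eq_ramificationIdx q P Gal(L/K)]

lemma prod_smul_prime {q : Ideal (𝓞 K)} [q.IsMaximal] (hq : q ≠ 0) (P : Ideal (𝓞 L))
    [P.IsPrime] [P.LiesOver q] :
    ∏ g : Gal(L/K), g • P = (q.map (algebraMap (𝓞 K) (𝓞 L))) ^ q.inertiaDegIn (𝓞 L) := by
  classical
  have hm : ∀ g ∈ (Finset.univ : Finset Gal(L/K)), g • P ∈ (q.primesOver (𝓞 L)).toFinset := by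
    intro g _
    rw [Set.mem_toFinset]
    exact ⟨inferInstance, inferInstance⟩
  have : Finite (𝓞 K ⧸ q) := Ideal.finiteQuotientOfFreeOfNeBot q hq
  have : PerfectField q.ResidueField := by
    have : Finite q.ResidueField := Finite.of_surjective _ (Ideal.bijective_algebraMap_quotient_residueField q).2
    infer_instance
  have hs := Ideal.card_stabilizer_eq (G := Gal(L/K)) q P
  rw [map_eq_Rad_pow K L hq, ← pow_mul, ← hs, Rad_eq, ← Finset.prod_pow,
    ← Finset.prod_fiberwise_of_maps_to hm]
  refine Finset.prod_congr rfl fun Q hQ => ?_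
  have hQ := Set.mem_toFinset.mp hQ
  have := hQ.1
  have := hQ.2
  obtain ⟨h, rfl⟩ := Ideal.exists_smul_eq_of_isGaloisGroup q P Q Gal(L/K)
  rw [Finset.prod_congr rfl (g := fun _ => h • P) (fun x hx => (Finset.mem_filter.mp hx).2),
    Finset.prod_const]
  congr 1
  rw [← Fintype.card_subtype, ← Nat.card_eq_fintype_card]
  refine Nat.card_congr ⟨fun x => ⟨h⁻¹ * x.1, ?_⟩, fun x => ⟨h * x.1, ?_⟩, ?_, ?_⟩
  · rw [MulAction.mem_stabilizer_iff, mul_smul, x.2, inv_smul_smul]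
  · rw [mul_smul, MulAction.mem_stabilizer_iff.mp x.2]
  · intro x
    ext1
    simp
  · intro x
    ext1
    simp

lemma prod_act_mem (p : ℕ) (σ : Gal(L/K)) (hσ : ∀ g, g ∈ Subgroup.zpowers σ) (ho : orderOf σ = p)
    (c : ClassGroup (𝓞 L)) :
    ∏ i ∈ Finset.range p, ((act σ)^[i]) c ∈ (ClassGroup.extendedHom (𝓞 K) (𝓞 L)).range := by
  classical
  have hit : ∀ (i : ℕ) {I : Ideal (𝓞 L)}, I ≠ 0 → ((act σ)^[i]) (cl I) = cl (σ ^ i • I) := by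
    intro i
    induction i with
    | zero => intro I _; simp
    | succ i ih =>
      intro I hI
      rw [Function.iterate_succ_apply, act_cl σ hI, ih (smul_ne_zero'' σ hI), pow_succ, mul_smul]
  have key : ∀ I : Ideal (𝓞 L), I ≠ 0 →
      ∏ i ∈ Finset.range p, ((act σ)^[i]) (cl I) = cl (∏ g : Gal(L/K), g • I) := by
    intro I hI
    rw [cl_prod _ _ (fun g _ => smul_ne_zero'' g hI), ← IsCyclic.image_range_orderOf hσ,
      Finset.prod_image, ho]
    · exact Finset.prod_congr rfl fun i _ => hit i hI
    · intro a ha b hb h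
      exact pow_injOn_Iio_orderOf (by simpa using ha) (by simpa using hb) h
  obtain ⟨I, hI, rfl⟩ := cl_surj c
  rw [key I hI]
  clear key
  induction I using UniqueFactorizationMonoid.induction_on_prime with
  | h₁ => exact absurd rfl hI
  | h₂ I h =>
    have : I = 1 := by simpa using h
    subst this
    have h1 : ∏ g : Gal(L/K), g • (1 : Ideal (𝓞 L)) = 1 := by
      refine Finset.prod_eq_one fun g _ => ?_
      exact smul_one g
    rw [h1, cl_one]
    exact one_mem _
  | h₃ I P hI' hP ih =>
    simp only [smul_mul', Finset.prod_mul_distrib]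
    rw [cl_mul]
    · refine mul_mem ?_ (ih hI')
      have hPp : P.IsPrime := Ideal.isPrime_of_prime hP
      have hP0 : P ≠ ⊥ := hP.ne_zero
      have : P.IsMaximal := hPp.isMaximal hP0
      have hq : P.under (𝓞 K) ≠ ⊥ := Ideal.under_ne_bot (𝓞 K) hP0
      rw [prod_smul_prime K L (q := P.under (𝓞 K)) hq P, cl_pow, ← ext_cl K L hq]
      · exact Subgroup.pow_mem _ (MonoidHom.mem_range.mpr ⟨_, rfl⟩) _
      · exact Ideal.map_ne_bot_of_ne_bot hq
    · exact Finset.prod_ne_zero_iff.mpr fun g _ => smul_ne_zero'' g hP.ne_zero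
    · exact Finset.prod_ne_zero_iff.mpr fun g _ => smul_ne_zero'' g hI'

lemma Rad_smul (q : Ideal (𝓞 K)) [q.IsMaximal] (g : Gal(L/K)) : g • Rad K L q = Rad K L q := by
  rw [Rad_eq, Finset.smul_prod']
  refine Finset.prod_bij (fun P _ => g • P) ?_ ?_ ?_ ?_
  · intro P hP
    rw [Set.mem_toFinset] at hP ⊢
    have := hP.1
    have := hP.2
    exact ⟨inferInstance, inferInstance⟩
  · intro a _ b _ h
    exact smul_left_cancel g h
  · intro P hP
    rw [Set.mem_toFinset] at hP
    have := hP.1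
    have := hP.2
    refine ⟨g⁻¹ • P, ?_, smul_inv_smul g P⟩
    rw [Set.mem_toFinset]
    exact ⟨inferInstance, inferInstance⟩
  · intro a _
    rfl

/-- An invariant ideal divisible by a prime above `q` is divisible by `Rad q`. -/
lemma Rad_dvd {q : Ideal (𝓞 K)} [q.IsMaximal] (hq : q ≠ 0) {I : Ideal (𝓞 L)}
    (hI : ∀ g : Gal(L/K), g • I = I) {P : Ideal (𝓞 L)} (hP : P ∈ q.primesOver (𝓞 L))
    (hPI : P ∣ I) : Rad K L q ∣ I := by
  rw [Rad_eq]
  refine Finset.prod_primes_dvd _ ?_ ?_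
  · intro Q hQ
    rw [Set.mem_toFinset] at hQ
    exact Ideal.prime_of_isPrime (over_ne_zero K L hq hQ) hQ.1
  · intro Q hQ
    rw [Set.mem_toFinset] at hQ
    have := hP.1
    have := hP.2
    have := hQ.1
    have := hQ.2
    obtain ⟨h, rfl⟩ := Ideal.exists_smul_eq_of_isGaloisGroup q P Q Gal(L/K)
    rw [← hI h]
    obtain ⟨J, rfl⟩ := hPI
    exact ⟨h • J, by rw [smul_mul']⟩

lemma inv_mem' (S : Subgroup (ClassGroup (𝓞 L))) (I : Ideal (𝓞 L)) (hI0 : I ≠ 0)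
    (hI : ∀ g : Gal(L/K), g • I = I)
    (h : ∀ q : Ideal (𝓞 K), q ≠ 0 → q.IsMaximal → (∃ P ∈ q.primesOver (𝓞 L), P ∣ I) →
      cl (Rad K L q) ∈ S) : cl I ∈ S := by
  induction I using WellFoundedGT.induction with
  | ind I ih =>
    by_cases h1 : I = ⊤
    · rw [h1, ← Ideal.one_eq_top, cl_one]
      exact one_mem _
    obtain ⟨P, hPm, hPI⟩ := Ideal.exists_le_maximal I h1
    have hPd : P ∣ I := Ideal.dvd_iff_le.mpr hPI
    have hP0 : P ≠ ⊥ := fun h => hI0 (by rw [h] at hPI; exact le_bot_iff.mp hPI)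
    have hq : P.under (𝓞 K) ≠ ⊥ := Ideal.under_ne_bot (𝓞 K) hP0
    have hqm : (P.under (𝓞 K)).IsMaximal := inferInstance
    have hPo : P ∈ (P.under (𝓞 K)).primesOver (𝓞 L) := ⟨hPm.isPrime, inferInstance⟩
    obtain ⟨J, hJ⟩ := Rad_dvd K L hq hI hPo hPd
    have hR := Rad_ne_zero K L hq
    have hJ0 : J ≠ 0 := by
      rintro rfl
      exact hI0 (by rw [hJ, mul_zero])
    rw [hJ, cl_mul hR hJ0]
    refine mul_mem (h _ hq hqm ⟨P, hPo, hPd⟩) ?_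
    refine ih J ?_ hJ0 ?_ ?_
    · have hle : I ≤ J := Ideal.dvd_iff_le.mp ⟨_, by rw [hJ, mul_comm]⟩
      refine lt_of_le_of_ne hle ?_
      rintro rfl
      have h2 : Rad K L (P.under (𝓞 K)) = 1 := by
        refine mul_right_cancel₀ hJ0 ?_
        rw [← hJ, one_mul]
      have h3 : P ∣ Rad K L (P.under (𝓞 K)) := by
        rw [Rad_eq]
        exact Finset.dvd_prod_of_mem _ (Set.mem_toFinset.mpr hPo)
      rw [h2, ← isUnit_iff_dvd_one, Ideal.isUnit_iff] at h3
      exact hPm.ne_top h3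
    · intro g
      refine mul_left_cancel₀ hR ?_
      rw [← hJ, ← hI g, hJ, smul_mul', Rad_smul]
    · rintro q hq0 hqm ⟨Q, hQ, hQJ⟩
      exact h q hq0 hqm ⟨Q, hQ, hQJ.trans ⟨_, by rw [hJ, mul_comm]⟩⟩

end galois

section ambiguous

set_option linter.unusedSectionVars false

variable (K L : Type) [Field K] [NumberField K] [Field L] [NumberField L] [Algebra K L]

lemma smul_coe (g : Gal(L/K)) (x : 𝓞 L) : ((g • x : 𝓞 L) : L) = g x := rfl

lemma smul_algebraMap_int (g : Gal(L/K)) (x : 𝓞 K) :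
    g • (algebraMap (𝓞 K) (𝓞 L) x) = algebraMap (𝓞 K) (𝓞 L) x := by
  apply RingOfIntegers.ext
  rw [smul_coe]
  exact g.commutes (x : K)

/-- The norm-unit attached to an ambiguous class. -/
def QQ (σ : Gal(L/K)) (c : ClassGroup (𝓞 L)) (u : (𝓞 K)ˣ) : Prop :=
  ∃ (I : Ideal (𝓞 L)) (x y : 𝓞 L), I ≠ 0 ∧ x ≠ 0 ∧ y ≠ 0 ∧ cl I = c ∧
    Ideal.span {x} * (σ • I) = Ideal.span {y} * I ∧
    Algebra.intNorm (𝓞 K) (𝓞 L) x = u * Algebra.intNorm (𝓞 K) (𝓞 L) y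

lemma QQ_exists (σ : Gal(L/K)) (c : ClassGroup (𝓞 L)) (hc : act σ c = c) :
    ∃ u, QQ K L σ c u := by
  obtain ⟨I, hI, rfl⟩ := cl_surj c
  rw [act_cl σ hI] at hc
  obtain ⟨x, y, hx, hy, h⟩ := cl_eq_cl (smul_ne_zero'' σ hI) hI hc
  have : SMulCommClass Gal(L/K) (𝓞 K) (𝓞 L) :=
    ⟨fun g a b => by rw [Algebra.smul_def, Algebra.smul_def, smul_mul', smul_algebraMap_int]⟩
  have h2 := congrArg (Ideal.relNorm (𝓞 K)) h
  rw [map_mul, map_mul, Ideal.relNorm_smul, Ideal.relNorm_singleton, Ideal.relNorm_singleton] at h2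
  have h3 : Ideal.relNorm (𝓞 K) I ≠ 0 := by
    rw [Ne, Ideal.zero_eq_bot, Ideal.relNorm_eq_bot_iff]
    exact hI
  have h4 := mul_right_cancel₀ h3 h2
  rw [Ideal.span_singleton_eq_span_singleton] at h4
  obtain ⟨u, hu⟩ := h4.symm
  exact ⟨u, I, x, y, hI, hx, hy, rfl, h, by rw [← hu, mul_comm]⟩

lemma QQ_mul (σ : Gal(L/K)) {c d : ClassGroup (𝓞 L)} {u v : (𝓞 K)ˣ} (h1 : QQ K L σ c u)
    (h2 : QQ K L σ d v) : QQ K L σ (c * d) (u * v) := by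
  obtain ⟨I, x, y, hI, hx, hy, rfl, h, hu⟩ := h1
  obtain ⟨J, z, w, hJ, hz, hw, rfl, h', hv⟩ := h2
  refine ⟨I * J, x * z, y * w, mul_ne_zero hI hJ, mul_ne_zero hx hz, mul_ne_zero hy hw,
    cl_mul hI hJ, ?_, ?_⟩
  · rw [smul_mul', ← Ideal.span_singleton_mul_span_singleton,
      ← Ideal.span_singleton_mul_span_singleton, mul_mul_mul_comm, h, h', mul_mul_mul_comm]
  · rw [map_mul, map_mul, hu, hv, Units.val_mul, mul_mul_mul_comm]

lemma QQ_one (σ : Gal(L/K)) : QQ K L σ 1 1 :=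
  ⟨1, 1, 1, one_ne_zero, one_ne_zero, one_ne_zero, cl_one, by rw [smul_one], by simp⟩

lemma QQ_pow (σ : Gal(L/K)) {c : ClassGroup (𝓞 L)} {u : (𝓞 K)ˣ} (h1 : QQ K L σ c u) (n : ℕ) :
    QQ K L σ (c ^ n) (u ^ n) := by
  induction n with
  | zero => simpa using QQ_one K L σ
  | succ n ih => rw [pow_succ, pow_succ]; exact QQ_mul K L σ ih h1

lemma exists_beta [IsGalois K L] (σ : Gal(L/K)) (hσ : ∀ g, g ∈ Subgroup.zpowers σ)
    (x y : 𝓞 L) (hy : y ≠ 0)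
    (h : Algebra.intNorm (𝓞 K) (𝓞 L) x = Algebra.intNorm (𝓞 K) (𝓞 L) y) :
    ∃ b : 𝓞 L, b ≠ 0 ∧ b * y = x * (σ • b) := by
  have hy' : (y : L) ≠ 0 := by simpa using hy
  have hc : IsCyclic Gal(L/K) := ⟨σ, hσ⟩
  have hn : Algebra.norm K (x : L) = Algebra.norm K (y : L) := by
    rw [← Algebra.algebraMap_intNorm (A := 𝓞 K) (B := 𝓞 L), h,
      Algebra.algebraMap_intNorm (A := 𝓞 K) (B := 𝓞 L) (K := K) (L := L)]
  have h1 : Algebra.norm K ((x : L) / y) = 1 := by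
    have h0 : Algebra.norm K (y : L) ≠ 0 := by rwa [Algebra.norm_ne_zero_iff]
    refine mul_right_cancel₀ h0 ?_
    rw [← map_mul, div_mul_cancel₀ _ hy', hn, one_mul]
  obtain ⟨b, hb⟩ := groupCohomology.exists_div_of_norm_eq_one hσ h1
  have hb0 : (b : L) ≠ 0 := b.ne_zero
  have hs0 : σ (b : L) ≠ 0 := by simp
  rw [div_eq_div_iff hs0 hy'] at hb
  obtain ⟨d, hd, hi⟩ := IsAlgebraic.exists_integral_multiple
    (R := ℤ) (z := (b : L)) ((IsFractionRing.isAlgebraic_iff ℤ ℚ L).mpr (Algebra.IsAlgebraic.isAlgebraic _))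
  have hd' : (d : L) ≠ 0 := by exact_mod_cast hd
  obtain ⟨β, hβ⟩ : ∃ β : 𝓞 L, (β : L) = d • (b : L) := ⟨⟨_, hi⟩, rfl⟩
  refine ⟨β, ?_, ?_⟩
  · rintro rfl
    simp [hd] at hβ
  · apply FaithfulSMul.algebraMap_injective (𝓞 L) L
    rw [map_mul, map_mul]
    change (β : L) * (y : L) = (x : L) * σ (β : L)
    rw [hβ, zsmul_eq_mul, map_mul, map_intCast, mul_assoc, hb]
    ring

lemma QQ_inv [IsGalois K L] (p : ℕ) (hfr : Module.finrank K L = p) (σ : Gal(L/K))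
    (hσ : ∀ g, g ∈ Subgroup.zpowers σ) {c : ClassGroup (𝓞 L)} {w : (𝓞 K)ˣ}
    (hQ : QQ K L σ c (w ^ p)) :
    ∃ J : Ideal (𝓞 L), J ≠ 0 ∧ (∀ g : Gal(L/K), g • J = J) ∧ cl J = c := by
  obtain ⟨I, x, y, hI, hx, hy, rfl, h, hu⟩ := hQ
  have hw : algebraMap (𝓞 K) (𝓞 L) w ≠ 0 := by
    simp
  obtain ⟨b, hb0, hb⟩ := exists_beta K L σ hσ x (algebraMap (𝓞 K) (𝓞 L) w * y)
    (mul_ne_zero hw hy) (by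
      rw [hu, map_mul]
      congr 1
      apply FaithfulSMul.algebraMap_injective (𝓞 K) K
      rw [Algebra.algebraMap_intNorm (A := 𝓞 K) (B := 𝓞 L) (K := K) (L := L)]
      change _ = Algebra.norm K (algebraMap K L (w : 𝓞 K))
      rw [Algebra.norm_algebraMap, hfr]
      simp)
  obtain ⟨γ, hγ⟩ := Algebra.dvd_algebraMap_intNorm_self (𝓞 K) (𝓞 L) b
  set n := algebraMap (𝓞 K) (𝓞 L) (Algebra.intNorm (𝓞 K) (𝓞 L) b) with hn
  have hn0 : n ≠ 0 := by
    rw [hn, Ne, FaithfulSMul.algebraMap_eq_zero_iff]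
    exact Algebra.intNorm_ne_zero.mpr hb0
  have hγ0 : γ ≠ 0 := by
    rintro rfl
    exact hn0 (by rw [hγ, mul_zero])
  have hσn : (σ • b) * (σ • γ) = b * γ := by
    rw [← smul_mul', ← hγ, hn, smul_algebraMap_int]
  have hwu : Ideal.span {algebraMap (𝓞 K) (𝓞 L) w} = 1 := by
    rw [Ideal.one_eq_top, Ideal.span_singleton_eq_top]
    exact w.isUnit.map _
  have e1 : Ideal.span {b} * (σ • I) = Ideal.span {σ • b} * I := by
    have h5 := congrArg (fun z => Ideal.span {z}) hb
    simp only [← Ideal.span_singleton_mul_span_singleton, hwu, one_mul] at h5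
    refine mul_left_cancel₀ (span_ne_zero' hx) ?_
    rw [mul_left_comm, h, ← mul_assoc, h5, mul_assoc]
  have hinv : σ • (Ideal.span {γ} * I) = Ideal.span {γ} * I := by
    refine mul_left_cancel₀ (span_ne_zero' hb0) ?_
    rw [smul_mul', smul_span, mul_left_comm, e1, ← mul_assoc, ← mul_assoc,
      Ideal.span_singleton_mul_span_singleton, Ideal.span_singleton_mul_span_singleton,
      mul_comm, mul_comm (σ • γ), hσn, mul_comm]
  refine ⟨Ideal.span {γ} * I, mul_ne_zero (span_ne_zero' hγ0) hI, ?_, ?_⟩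
  · intro g
    have h6 : Subgroup.zpowers σ ≤ MulAction.stabilizer Gal(L/K) (Ideal.span {γ} * I) := by
      rw [Subgroup.zpowers_le]
      exact hinv
    exact h6 (hσ g)
  · rw [cl_mul (span_ne_zero' hγ0) hI, cl_span, one_mul]

/-- Bounding the ambiguous `p`-torsion classes. -/
lemma card_ambiguous [IsGalois K L] (p : ℕ) [Fact p.Prime] (hpodd : Odd p)
    [IsCyclotomicExtension {p} ℚ K]
    (hfr : Module.finrank K L = p) (σ : Gal(L/K))
    (hσ : ∀ g, g ∈ Subgroup.zpowers σ) (S : Subgroup (ClassGroup (𝓞 L)))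
    (hS : ∀ J : Ideal (𝓞 L), J ≠ 0 → (∀ g : Gal(L/K), g • J = J) → cl J ∈ S) :
    Nat.card {c : ClassGroup (𝓞 L) // c ^ p = 1 ∧ act σ c = c} ≤
      p ^ ((p - 1) / 2) * Nat.card (tors p S) := by
  classical
  have hp : p.Prime := Fact.out
  obtain ⟨X, _, φ, hX, hφ⟩ := units_mod p hpodd K
  have hu : ∀ c : {c : ClassGroup (𝓞 L) // c ^ p = 1 ∧ act σ c = c}, ∃ u, QQ K L σ c u :=
    fun c => QQ_exists K L σ c c.2.2
  choose u hu using hu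
  have key : ∀ c d, φ (u c) = φ (u d) → (c : ClassGroup (𝓞 L)) * (d : ClassGroup (𝓞 L))⁻¹ ∈ S := by
    intro c d h
    obtain ⟨w, hw⟩ := hφ _ _ h
    have h1 := QQ_mul K L σ (hu c) (QQ_pow K L σ (hu d) (p - 1))
    have h2 : u c * u d ^ (p - 1) = (w * u d) ^ p := by
      rw [hw, mul_pow, mul_right_comm, ← pow_succ', Nat.sub_add_cancel hp.one_le, mul_comm]
    have h3 : (d : ClassGroup (𝓞 L)) ^ (p - 1) = (d : ClassGroup (𝓞 L))⁻¹ := by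
      rw [eq_inv_iff_mul_eq_one, ← pow_succ, Nat.sub_add_cancel hp.one_le, d.2.1]
    rw [h2, h3] at h1
    obtain ⟨J, hJ0, hJ, hcl⟩ := QQ_inv K L p hfr σ hσ h1
    rw [← hcl]
    exact hS J hJ0 hJ
  -- choose representatives of the fibres
  let r : X → {c : ClassGroup (𝓞 L) // c ^ p = 1 ∧ act σ c = c} := fun a =>
    if h : ∃ c, φ (u c) = a then h.choose else ⟨1, by simp⟩
  have hr : ∀ c, φ (u c) = φ (u (r (φ (u c)))) := by
    intro c
    have h : ∃ d, φ (u d) = φ (u c) := ⟨c, rfl⟩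
    have h2 : r (φ (u c)) = h.choose := dif_pos h
    rw [h2]
    exact h.choose_spec.symm
  let F : {c : ClassGroup (𝓞 L) // c ^ p = 1 ∧ act σ c = c} → X × tors p S := fun c =>
    (φ (u c), ⟨⟨c * ((r (φ (u c)) : _) : ClassGroup (𝓞 L))⁻¹, key _ _ (hr c)⟩, by
      rw [mem_tors]
      ext
      simp [mul_pow, c.2.1, (r (φ (u c))).2.1]⟩)
  have hF : Function.Injective F := by
    intro c d h
    have h1 : φ (u c) = φ (u d) := congrArg Prod.fst h
    have h2 : (c : ClassGroup (𝓞 L)) * ((r (φ (u c)) : _) : ClassGroup (𝓞 L))⁻¹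
      = d * ((r (φ (u d)) : _) : ClassGroup (𝓞 L))⁻¹ :=
        congrArg (fun z : X × tors p S => (z.2 : ClassGroup (𝓞 L))) h
    rw [h1] at h2
    exact Subtype.ext (mul_right_cancel h2)
  refine (Nat.card_le_card_of_injective F hF).trans ?_
  rw [Nat.card_prod]
  exact Nat.mul_le_mul_right _ hX

end ambiguous

section unramified

set_option linter.unusedSectionVars false

attribute [local instance] FractionRing.liftAlgebra

variable (K L : Type) [Field K] [NumberField K] [Field L] [NumberField L] [Algebra K L]

lemma ram_eq_one (P : Ideal (𝓞 L)) [P.IsPrime] (h : ¬ P ∣ differentIdeal (𝓞 K) (𝓞 L)) :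
    P.ramificationIdx (𝓞 K) = 1 := by
  have : Algebra.IsSeparable (FractionRing (𝓞 K)) (FractionRing (𝓞 L)) := inferInstance
  have := not_dvd_differentIdeal_iff.mp h
  exact Ideal.ramificationIdx_eq_one P (𝓞 K)

lemma mem_different (p N : ℕ) (a : 𝓞 L)
    (hmin : minpoly K (a : L) = X ^ p - C (N : K))
    (hgen : Algebra.adjoin K {(a : L)} = ⊤) :
    (p : 𝓞 L) * a ^ (p - 1) ∈ differentIdeal (𝓞 K) (𝓞 L) := by
  have h := aeval_derivative_mem_differentIdeal (𝓞 K) K L a hgen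
  have h2 : minpoly (𝓞 K) a = X ^ p - C (N : 𝓞 K) := by
    apply Polynomial.map_injective _ (FaithfulSMul.algebraMap_injective (𝓞 K) K)
    rw [← minpoly.isIntegrallyClosed_eq_field_fractions K L (Algebra.IsIntegral.isIntegral a)]
    rw [Polynomial.map_sub, Polynomial.map_pow, Polynomial.map_X, Polynomial.map_C, map_natCast]
    exact hmin
  rw [h2] at h
  simpa [Polynomial.derivative_X_pow] using h

lemma Rad_mem_range [IsGalois K L] (p N : ℕ) (a : 𝓞 L) (hap : a ^ p = N)
    (hmin : minpoly K (a : L) = X ^ p - C (N : K))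
    (hgen : Algebra.adjoin K {(a : L)} = ⊤) {q : Ideal (𝓞 K)} [q.IsMaximal] (hq : q ≠ 0)
    {P : Ideal (𝓞 L)} (hP : P ∈ q.primesOver (𝓞 L)) (h1 : (p : 𝓞 L) ∉ P) (h2 : (N : 𝓞 L) ∉ P) :
    cl (Rad K L q) ∈ (ClassGroup.extendedHom (𝓞 K) (𝓞 L)).range := by
  have hPp := hP.1
  have := hP.2
  have h3 : P.ramificationIdx (𝓞 K) = 1 := by
    apply ram_eq_one
    intro h
    have h4 := Ideal.dvd_iff_le.mp h (mem_different K L p N a hmin hgen)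
    rcases hPp.mem_or_mem h4 with h5 | h5
    · exact h1 h5
    · apply h2
      rw [← hap]
      have h6 : a ∈ P := hPp.mem_of_pow_mem _ h5
      rcases Nat.eq_zero_or_pos p with rfl | hp
      · simp at h1
      · exact Ideal.pow_mem_of_mem _ h6 _ hp
  have h4 := map_eq_Rad_pow K L hq
  rw [Ideal.ramificationIdxIn_eq_ramificationIdx q P Gal(L/K), h3, pow_one] at h4
  rw [← h4, ← ext_cl K L hq]
  exact ⟨_, rfl⟩

end unramified

section base

set_option linter.unusedSectionVars false

variable (p N : ℕ) [Fact p.Prime] [Fact N.Prime]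
  (K : Type) [Field K] [NumberField K] [IsCyclotomicExtension {p} ℚ K]

lemma ncard_over_N : ((Ideal.span {(N : ℤ)}).primesOver (𝓞 K)).ncard ≤ p - 1 := by
  have hp : p.Prime := Fact.out
  have hN : N.Prime := Fact.out
  have : NeZero p := ⟨hp.ne_zero⟩
  have : IsGalois ℚ K := IsCyclotomicExtension.isGalois {p} ℚ K
  have hpr : (Ideal.span {(N : ℤ)}).IsPrime := by
    rw [Ideal.span_singleton_prime (by exact_mod_cast hN.ne_zero)]
    exact Nat.prime_iff_prime_int.mp hN
  have h := Ideal.ncard_primesOver_mul_ramificationIdxIn_mul_inertiaDegIn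
    (Ideal.span {(N : ℤ)}) (𝓞 K) Gal(K/ℚ)
  have h2 : Nat.card Gal(K/ℚ) = p - 1 := by
    rw [IsGalois.card_aut_eq_finrank, IsCyclotomicExtension.finrank (n := p) K
      (Polynomial.cyclotomic.irreducible_rat hp.pos), Nat.totient_prime hp]
  rw [h2] at h
  have hpos : 0 < p - 1 := by have := hp.two_le; omega
  exact Nat.le_of_dvd hpos ⟨_, h.symm⟩

lemma lies_N {N : ℕ} (hN : N.Prime) {q : Ideal (𝓞 K)} (hq : q.IsMaximal) (h : (N : 𝓞 K) ∈ q) :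
    q.LiesOver (Ideal.span {(N : ℤ)}) := by
  rw [Ideal.liesOver_span_iff hq.ne_top (Nat.prime_iff_prime_int.mp hN)]
  simpa using h

lemma not_sq_dvd (hNp : N ≠ p) (q : Ideal (𝓞 K)) (hq0 : q ≠ 0) [q.IsMaximal] [q.LiesOver (Ideal.span {(N : ℤ)})] :
    ¬ q ^ 2 ∣ Ideal.span {(N : 𝓞 K)} := by
  have hp : p.Prime := Fact.out
  have hN : N.Prime := Fact.out
  have : NeZero p := ⟨hp.ne_zero⟩
  have hnd : ¬ N ∣ p := fun h => hNp ((Nat.prime_dvd_prime_iff_eq hN hp).mp h)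
  have hNZ : Ideal.span {(N : ℤ)} ≠ 0 := span_ne_zero' (by exact_mod_cast hN.ne_zero)
  have hpr : (Ideal.span {(N : ℤ)}).IsPrime := by
    rw [Ideal.span_singleton_prime (by exact_mod_cast hN.ne_zero)]
    exact Nat.prime_iff_prime_int.mp hN
  have hmx : (Ideal.span {(N : ℤ)}).IsMaximal := hpr.isMaximal hNZ
  have h := Ideal.map_algebraMap_eq_finsetProd_pow (S := ℤ) (R := 𝓞 K) hNZ
  rw [Ideal.map_span, Set.image_singleton, algebraMap_int_eq, eq_intCast, Int.cast_natCast] at h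
  rw [h]
  intro hd
  have h3 : ∏ P ∈ ((Ideal.span {(N : ℤ)}).primesOver (𝓞 K)).toFinset, P ^ P.ramificationIdx ℤ
      = ∏ P ∈ ((Ideal.span {(N : ℤ)}).primesOver (𝓞 K)).toFinset, P := by
    refine Finset.prod_congr rfl fun P hP => ?_
    rw [Set.mem_toFinset] at hP
    have := hP.1
    have := hP.2
    rw [IsCyclotomicExtension.Rat.ramificationIdx_eq_of_not_dvd N K P hnd, pow_one]
  have hq : q ∈ ((Ideal.span {(N : ℤ)}).primesOver (𝓞 K)).toFinset := by
    rw [Set.mem_toFinset]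
    exact ⟨inferInstance, inferInstance⟩
  classical
  rw [h3, ← Finset.mul_prod_erase _ _ hq, sq] at hd
  have h4 := (mul_dvd_mul_iff_left hq0).mp hd
  have hqp : Prime q := Ideal.prime_of_isPrime hq0 inferInstance
  obtain ⟨P, hP, hdP⟩ := (Prime.dvd_finsetProd_iff hqp _).mp h4
  rw [Finset.mem_erase, Set.mem_toFinset] at hP
  have hPm : P.IsPrime := hP.2.1
  have hle := Ideal.dvd_iff_le.mp hdP
  have hP0 : P ≠ ⊥ := by
    have := hP.2.2
    exact Ideal.ne_bot_of_liesOver_of_ne_bot hNZ P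
  exact hP.1 ((hPm.isMaximal hP0).eq_of_le (Ideal.IsPrime.ne_top inferInstance) hle)

end base

section final

lemma exists_gens (p N : ℕ) [Fact p.Prime] [Fact N.Prime] (hNp : N ≠ p)
    (K L : Type) [Field K] [NumberField K] [Field L] [NumberField L] [Algebra K L]
    [IsCyclotomicExtension {p} ℚ K] [IsGalois K L]
    (hfr : Module.finrank K L = p) (a : 𝓞 L) (hap : a ^ p = N)
    (hmin : minpoly K (a : L) = X ^ p - C (N : K))
    (hgen : Algebra.adjoin K {(a : L)} = ⊤)
    (hinv : ∀ g : Gal(L/K), g • Ideal.span {a} = Ideal.span {a}) :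
    ∃ s : Finset (Ideal (𝓞 K)), s.card ≤ p - 1 ∧ ∀ J : Ideal (𝓞 L), J ≠ 0 →
      (∀ g : Gal(L/K), g • J = J) →
      cl J ∈ (ClassGroup.extendedHom (𝓞 K) (𝓞 L)).range ⊔
        Subgroup.closure ((fun q => cl (Rad K L q)) '' (s : Set (Ideal (𝓞 K)))) := by
  classical
  have hp : p.Prime := Fact.out
  have hN : N.Prime := Fact.out
  have hNZ : Ideal.span {(N : ℤ)} ≠ 0 := span_ne_zero' (by exact_mod_cast hN.ne_zero)
  have hpr : (Ideal.span {(N : ℤ)}).IsPrime := by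
    rw [Ideal.span_singleton_prime (by exact_mod_cast hN.ne_zero)]
    exact Nat.prime_iff_prime_int.mp hN
  have hmx : (Ideal.span {(N : ℤ)}).IsMaximal := hpr.isMaximal hNZ
  have hcard := ncard_over_N p N K
  rw [Set.ncard_eq_toFinset_card'] at hcard
  set T := ((Ideal.span {(N : ℤ)}).primesOver (𝓞 K)).toFinset with hT
  obtain ⟨q₀, hq₀⟩ : T.Nonempty := by
    rw [← Finset.card_pos, hT, ← Set.ncard_eq_toFinset_card']
    exact Nat.pos_of_ne_zero (IsDedekindDomain.primesOver_ncard_ne_zero _ _)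
  obtain ⟨ζ, hζ⟩ := IsCyclotomicExtension.exists_isPrimitiveRoot ℚ K
    (Set.mem_singleton p) hp.ne_zero
  let l : Ideal (𝓞 K) := Ideal.span {hζ.toInteger - 1}
  refine ⟨insert l (T.erase q₀), ?_, ?_⟩
  · refine (Finset.card_insert_le _ _).trans ?_
    rw [Finset.card_erase_of_mem hq₀, Nat.sub_add_cancel (Finset.card_pos.mpr ⟨q₀, hq₀⟩)]
    exact hcard
  set s := insert l (T.erase q₀) with hs
  set S := (ClassGroup.extendedHom (𝓞 K) (𝓞 L)).range ⊔
        Subgroup.closure ((fun q => cl (Rad K L q)) '' (s : Set (Ideal (𝓞 K)))) with hS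
  have hsS : ∀ q ∈ s, cl (Rad K L q) ∈ S := fun q hq =>
    Subgroup.mem_sup_right (Subgroup.subset_closure ⟨q, hq, rfl⟩)
  have mem_under : ∀ (n : ℕ) (q : Ideal (𝓞 K)) (P : Ideal (𝓞 L)), P ∈ q.primesOver (𝓞 L) →
      (n : 𝓞 L) ∈ P → (n : 𝓞 K) ∈ q := by
    intro n q P hP h
    rw [hP.2.over, Ideal.mem_comap, map_natCast]
    exact h
  have hTmem : ∀ q : Ideal (𝓞 K), q.IsMaximal → (N : 𝓞 K) ∈ q → q ∈ T := by
    intro q hq h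
    rw [hT, Set.mem_toFinset]
    exact ⟨hq.isPrime, lies_N K hN hq h⟩
  have ha0 : a ≠ 0 := by
    rintro rfl
    rw [zero_pow hp.ne_zero] at hap
    exact hN.ne_zero (by exact_mod_cast hap.symm)
  -- the prime `q₀`
  rw [hT, Set.mem_toFinset] at hq₀
  have hq₀p := hq₀.1
  have hq₀l := hq₀.2
  have hq₀0 : q₀ ≠ ⊥ := Ideal.ne_bot_of_liesOver_of_ne_bot hNZ q₀
  have hq₀m : q₀.IsMaximal := hq₀p.isMaximal hq₀0
  have hNq₀ : (N : 𝓞 K) ∈ q₀ := by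
    have := (Ideal.liesOver_span_iff hq₀m.ne_top (Nat.prime_iff_prime_int.mp hN)).mp hq₀l
    simpa using this
  have hq₀S : cl (Rad K L q₀) ∈ S := by
    obtain ⟨P, hP⟩ : (q₀.primesOver (𝓞 L)).Nonempty := by
      rw [← Set.ncard_pos (IsDedekindDomain.primesOver_finite q₀ (𝓞 L))]
      exact Nat.pos_of_ne_zero (IsDedekindDomain.primesOver_ncard_ne_zero _ _)
    have haP : a ∈ P := by
      have h1 : (N : 𝓞 L) ∈ P := by
        have := hNq₀
        rw [hP.2.over, Ideal.mem_comap, map_natCast] at this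
        exact this
      rw [← hap] at h1
      exact hP.1.mem_of_pow_mem _ h1
    have hPd : P ∣ Ideal.span {a} := by
      rwa [Ideal.dvd_span_singleton]
    obtain ⟨b, hb⟩ := Rad_dvd K L hq₀0 hinv hP hPd
    have hR := Rad_ne_zero K L hq₀0
    have hb0 : b ≠ 0 := by
      rintro rfl
      rw [mul_zero] at hb
      exact span_ne_zero' ha0 hb
    have hbinv : ∀ g : Gal(L/K), g • b = b := by
      intro g
      refine mul_left_cancel₀ hR ?_
      rw [← hb, ← hinv g, hb, smul_mul', Rad_smul]
    have hbS : cl b ∈ S := by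
      refine inv_mem' K L S b hb0 hbinv ?_
      rintro q hq0 hqm ⟨Q, hQ, hQb⟩
      have hQa : a ∈ Q := by
        rw [← Ideal.dvd_span_singleton, hb]
        exact hQb.mul_left _
      have hNQ : (N : 𝓞 L) ∈ Q := by
        rw [← hap]
        exact Ideal.pow_mem_of_mem _ hQa _ hp.pos
      have hqT := hTmem q hqm (mem_under N q Q hQ hNQ)
      by_cases hqq : q = q₀
      · exfalso
        subst hqq
        obtain ⟨b', hb'⟩ := Rad_dvd K L hq0 hbinv hQ hQb
        have hPR : P ∣ Rad K L q := by
          rw [Rad_eq]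
          exact Finset.dvd_prod_of_mem _ (Set.mem_toFinset.mpr hP)
        have hPP : P ^ 2 ∣ Ideal.span {a} := by
          rw [hb, hb', sq, ← mul_assoc]
          exact Dvd.dvd.mul_right (mul_dvd_mul hPR hPR) _
        have hn : Ideal.relNorm (𝓞 K) (Ideal.span {a}) = Ideal.span {(N : 𝓞 K)} := by
          have h1 : Ideal.relNorm (𝓞 K) (Ideal.span {a}) ^ p = Ideal.span {(N : 𝓞 K)} ^ p := by
            rw [← map_pow, Ideal.span_singleton_pow, hap, Ideal.relNorm_singleton,
              Ideal.span_singleton_pow]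
            congr 2
            apply FaithfulSMul.algebraMap_injective (𝓞 K) K
            rw [Algebra.algebraMap_intNorm (A := 𝓞 K) (B := 𝓞 L) (K := K) (L := L), map_natCast,
              ← map_natCast (algebraMap K L), Algebra.norm_algebraMap, hfr]
            simp
          exact pow_left_injective hp.ne_zero h1
        have hd := map_dvd (Ideal.relNorm (𝓞 K)) hPP
        rw [hn, map_pow] at hd
        have hqP : q ∣ Ideal.relNorm (𝓞 K) P := by
          rw [Ideal.dvd_iff_le]
          refine (Ideal.relNorm_le_comap (𝓞 K) P).trans ?_
          rw [hP.2.over]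
        exact not_sq_dvd p N K hNp q hq0 ((pow_dvd_pow_of_dvd hqP 2).trans hd)
      · exact hsS q (Finset.mem_insert_of_mem (Finset.mem_erase.mpr ⟨hqq, hqT⟩))
    have h1 : cl (Rad K L q₀) * cl b = 1 := by
      rw [← cl_mul hR hb0, ← hb, cl_span]
    rw [eq_inv_of_mul_eq_one_left h1]
    exact inv_mem hbS
  intro J hJ0 hJ
  refine inv_mem' K L S J hJ0 hJ ?_
  rintro q hq0 hqm ⟨P, hP, -⟩
  by_cases h1 : (N : 𝓞 L) ∈ P
  · have hqT := hTmem q hqm (mem_under N q P hP h1)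
    by_cases hqq : q = q₀
    · rw [hqq]; exact hq₀S
    · exact hsS q (Finset.mem_insert_of_mem (Finset.mem_erase.mpr ⟨hqq, hqT⟩))
  by_cases h2 : (p : 𝓞 L) ∈ P
  · have hl := lies_N K hp hqm (mem_under p q P hP h2)
    have hql : q = l := IsCyclotomicExtension.Rat.eq_span_zeta_sub_one_of_liesOver' p K hζ q
    exact hsS q (by rw [hs, hql]; exact Finset.mem_insert_self _ _)
  · exact Subgroup.mem_sup_left (Rad_mem_range K L p N a hap hmin hgen hq0 hP h2 h1)

lemma not_pow (p N : ℕ) [Fact p.Prime] [Fact N.Prime] (K : Type) [Field K] [NumberField K]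
    [IsCyclotomicExtension {p} ℚ K] (b : K) : b ^ p ≠ (N : K) := by
  intro h
  have hp : p.Prime := Fact.out
  have hN : N.Prime := Fact.out
  have : NeZero p := ⟨hp.ne_zero⟩
  have hfr : Module.finrank ℚ K = p - 1 := by
    rw [IsCyclotomicExtension.finrank (n := p) K
      (Polynomial.cyclotomic.irreducible_rat hp.pos), Nat.totient_prime hp]
  have h1 := congrArg (Algebra.norm ℚ) h
  rw [map_pow, ← map_natCast (algebraMap ℚ K), Algebra.norm_algebraMap, hfr] at h1
  have h2 := congrArg (padicValRat N) h1
  have hNQ : (N : ℚ) ≠ 0 := by exact_mod_cast hN.ne_zero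
  have hb : Algebra.norm ℚ b ≠ 0 := by
    intro h0
    rw [h0, zero_pow hp.ne_zero] at h1
    exact pow_ne_zero _ hNQ h1.symm
  rw [padicValRat.pow, padicValRat.pow, padicValRat.self hN.one_lt, mul_one] at h2
  have h3 : (p : ℤ) ∣ ((p - 1 : ℕ) : ℤ) := ⟨_, h2.symm⟩
  have h4 := Nat.le_of_dvd (by have := hp.two_le; omega) (Int.natCast_dvd_natCast.mp h3)
  have := hp.two_le
  omega

end final

/-- Let `p` be an odd prime and `N ≠ p` a prime with `N ≡ 1 (mod p)`;
let `K = ℚ(ζ_p)` and `L = ℚ(ζ_p, N^{1/p})`.  Then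
`rk_p(Cl(L)) ≤ p·rk_p(Cl(K)) + (3/2)(p-1)²`. -/
theorem stmt6 (p N : ℕ) (hp : p.Prime) (hpodd : Odd p) (hN : N.Prime) (hNp : N ≠ p)
    (hmod : N ≡ 1 [MOD p])
    (K L : Type) [Field K] [NumberField K] [Field L] [NumberField L] [Algebra K L]
    (ζ : K) (hζ : IsPrimitiveRoot ζ p)
    (hKgen : Algebra.adjoin ℚ {ζ} = (⊤ : Subalgebra ℚ K))
    (α : L) (hα : α ^ p = (N : L))
    (hLgen : Algebra.adjoin K {α} = (⊤ : Subalgebra K L)) :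
    pRank p (ClassGroup (𝓞 L)) ≤ p * pRank p (ClassGroup (𝓞 K)) + 3 * (p - 1) ^ 2 / 2 := by
  have : Fact p.Prime := ⟨hp⟩
  have : Fact N.Prime := ⟨hN⟩
  have : NeZero p := ⟨hp.ne_zero⟩
  have hcyc : IsCyclotomicExtension {p} ℚ K := by
    rw [IsCyclotomicExtension.iff_singleton]
    refine ⟨⟨ζ, hζ⟩, fun x => ?_⟩
    have hx : x ∈ Algebra.adjoin ℚ {ζ} := by rw [hKgen]; trivial
    refine Algebra.adjoin_mono ?_ hx
    rw [Set.singleton_subset_iff]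
    exact hζ.pow_eq_one
  have hirr : Irreducible (X ^ p - C (N : K)) :=
    X_pow_sub_C_irreducible_of_prime hp (not_pow p N K)
  have hmin : minpoly K α = X ^ p - C (N : K) := by
    refine (minpoly.eq_of_irreducible_of_monic hirr ?_ (monic_X_pow_sub_C _ hp.ne_zero)).symm
    simp [hα]
  have hαint : IsIntegral K α := Algebra.IsIntegral.isIntegral α
  have htop : IntermediateField.adjoin K {α} = ⊤ := by
    rw [← IntermediateField.toSubalgebra_inj,
      IntermediateField.adjoin_simple_toSubalgebra_of_isAlgebraic hαint.isAlgebraic, hLgen]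
    rfl
  have hfr : Module.finrank K L = p := by
    rw [← IntermediateField.finrank_top', ← htop, IntermediateField.adjoin.finrank hαint, hmin,
      natDegree_X_pow_sub_C]
  have hprim : (primitiveRoots p K).Nonempty := ⟨ζ, (mem_primitiveRoots hp.pos).mpr hζ⟩
  have hspl : Polynomial.IsSplittingField K L (X ^ p - C (N : K)) := by
    have h := isSplittingField_X_pow_sub_C_of_root_adjoin_eq_top (K := K) (L := L)
      (by rw [hfr]; exact hprim) (a := (N : K)) (α := α) (by rw [hfr, hα]; simp) htop
    rwa [hfr] at h
  have hgal : IsGalois K L := isGalois_of_isSplittingField_X_pow_sub_C hprim hirr L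
  have hcycl : IsCyclic Gal(L/K) := isCyclic_of_isSplittingField_X_pow_sub_C hprim hirr L
  obtain ⟨σ, hσ⟩ := hcycl.exists_generator
  have hord : orderOf σ = p := by
    rw [orderOf_eq_card_of_forall_mem_zpowers hσ, IsGalois.card_aut_eq_finrank, hfr]
  obtain ⟨a, ha⟩ : ∃ a : 𝓞 L, (a : L) = α := by
    refine ⟨⟨α, ?_⟩, rfl⟩
    refine IsIntegral.of_pow hp.pos ?_
    rw [hα]
    exact_mod_cast (isIntegral_algebraMap : IsIntegral ℤ (algebraMap ℤ L (N : ℤ)))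
  have hap : a ^ p = N := by
    apply FaithfulSMul.algebraMap_injective (𝓞 L) L
    rw [map_pow, map_natCast]
    change (a : L) ^ p = N
    rw [ha, hα]
  have ha0 : a ≠ 0 := by
    rintro rfl
    rw [zero_pow hp.ne_zero] at hap
    exact hN.ne_zero (by exact_mod_cast hap.symm)
  have hinv : ∀ g : Gal(L/K), g • Ideal.span {a} = Ideal.span {a} := by
    intro g
    have h1 : (g • Ideal.span {a}) ^ p = Ideal.span {a} ^ p := by
      rw [smul_span, Ideal.span_singleton_pow, Ideal.span_singleton_pow, ← smul_pow', hap]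
      congr 2
      rw [← map_natCast (algebraMap (𝓞 K) (𝓞 L)), smul_algebraMap_int]
    exact pow_left_injective hp.ne_zero h1
  obtain ⟨s, hs, hS⟩ := exists_gens p N hNp K L hfr a hap (by rw [ha]; exact hmin)
    (by rw [ha]; exact hLgen) hinv
  have h1 := card_ambiguous K L p hpodd hfr σ hσ _ hS
  have h2 := card_tors_le_of_norm p (act σ) _ (prod_act_mem K L p σ hσ hord)
  have h3 := card_tors_sup_closure p hp.pos (ClassGroup.extendedHom (𝓞 K) (𝓞 L)).range s
    (fun q => cl (Rad K L q))
  have h4 := card_tors_range_le p (ClassGroup.extendedHom (𝓞 K) (𝓞 L))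
  rw [card_tors_eq_pow p (ClassGroup (𝓞 K))] at h4
  rw [card_tors_eq_pow p (ClassGroup (𝓞 L))] at h2
  set r := pRank p (ClassGroup (𝓞 K))
  have h5 : p ^ pRank p (ClassGroup (𝓞 L)) ≤
      (p ^ ((p - 1) / 2) * (p ^ r * p ^ (p - 1))) ^ (p - 1) * p ^ r := by
    refine h2.trans (Nat.mul_le_mul (Nat.pow_le_pow_left (h1.trans ?_) _) h4)
    refine Nat.mul_le_mul_left _ (h3.trans (Nat.mul_le_mul h4 ?_))
    exact Nat.pow_le_pow_right hp.pos hs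
  rw [← pow_add, ← pow_add, ← pow_mul, ← pow_add] at h5
  have h6 := (Nat.pow_le_pow_iff_right hp.one_lt).mp h5
  refine h6.trans (le_of_eq ?_)
  obtain ⟨k, rfl⟩ := hpodd
  have e1 : 2 * k + 1 - 1 = 2 * k := by omega
  have e2 : 2 * k / 2 = k := by omega
  have e3 : 3 * (2 * k) ^ 2 / 2 = 6 * k ^ 2 := by
    rw [show 3 * (2 * k) ^ 2 = (6 * k ^ 2) * 2 by ring]
    exact Nat.mul_div_cancel _ (by norm_num)
  rw [e1, e2, e3]
  ring
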